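/- arXiv:1802.03081 — 4 statements merged into one kernel-verified Lean document; each statement's English description precedes it below -/
import Mathlib

section
/- Let θ ∈ ℝ⁴ be such that 1, θ₁, …, θ₄ are linearly independent over ℚ, let (z_l) be a sequence of best approximations to θ, and assume that for every index k₀ the vectors {z_l : l ≥ k₀} span ℝ⁵. Then for every index k₀ there exist indices k₀ < r₀ < r₁ ≤ r₂ < r₃ such that: (1) for each 0 ≤ i ≤ 3, the triple z_{rᵢ−1}, z_{rᵢ}, z_{rᵢ+1} is linearly independent, spanning a 3-dimensional subspace S_{3,i}; (2) S_{3,1} = S_{3,2} =: Q; (3) the subgroup of ℤ⁵ generated by z_{r₀}, z_{r₀+1} equals the subgroup generated by z_{r₁−1}, z_{r₁}, and equals S_{3,0} ∩ S_{3,1} ∩ ℤ⁵; (4) the subgroup generated by z_{r₂}, z_{r₂+1} equals the subgroup generated by z_{r₃−1}, z_{r₃}, and equals S_{3,2} ∩ S_{3,3} ∩ ℤ⁵; (5) the quadruples {z_{r₀−1}, z_{r₀}, z_{r₀+1}, z_{r₁+1}} and {z_{r₂−1}, z_{r₃−1}, z_{r₃}, z_{r₃+1}} each consist of linearly independent vectors;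 (6) the five vectors z_{r₀−1}, z_{r₀}, z_{r₀+1}, z_{r₁+1}, z_{r₃+1} span ℝ⁵. -/
open scoped BigOperators

noncomputable section

/-- The real vector attached to an integer vector. -/
def vecR {m : ℕ} (z : Fin m → ℤ) : Fin m → ℝ := fun i => (z i : ℝ)

/-- The approximation error `ξ = max_i |q θ_i - a_i|` of a vector
`z = (q, a_1, …, a_n) ∈ ℤ^(n+1)`. -/
def xi {n : ℕ} (θ : Fin n → ℝ) (z : Fin (n + 1) → ℤ) : ℝ :=
  ⨆ i : Fin n, |(z 0 : ℝ) * θ i - (z i.succ : ℝ)|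

/-- A sequence of best approximations to `θ` for simultaneous approximation:
`z l = (q_l, a_{1,l}, …, a_{n,l})`, `q_l > 0`, `(q_l)` strictly increasing,
`(ξ_l)` strictly decreasing, and any `q` with `0 < q < q_{l+1}` approximates
no better than `ξ_l`. -/
def IsBestApproxSeq {n : ℕ} (θ : Fin n → ℝ) (z : ℕ → Fin (n + 1) → ℤ) : Prop :=
  (∀ l, 0 < z l 0) ∧
  (StrictMono fun l => z l 0) ∧
  (StrictAnti fun l => xi θ (z l)) ∧
  ∀ l : ℕ, ∀ q : ℤ, 0 < q → q < z (l + 1) 0 → ∀ a : Fin n → ℤ,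
    xi θ (z l) ≤ ⨆ i : Fin n, |(q : ℝ) * θ i - (a i : ℝ)|

/-- Gram matrix of a family of vectors in `ℝ^m` (standard inner product). -/
def gram {r m : ℕ} (v : Fin r → Fin m → ℝ) : Matrix (Fin r) (Fin r) ℝ :=
  Matrix.of (fun i j => ∑ k, v i k * v j k)

/-- Covolume (volume of a fundamental parallelepiped) of the lattice generated
by a linearly independent family of vectors of `ℝ^m`. -/
def covol {r m : ℕ} (v : Fin r → Fin m → ℝ) : ℝ := Real.sqrt (gram v).det

/-- The subgroup of integer points of `ℝ^m`. -/
def intPoints (m : ℕ) : AddSubgroup (Fin m → ℝ) where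
  carrier := {v | ∀ i, ∃ k : ℤ, v i = (k : ℝ)}
  zero_mem' := fun i => ⟨0, by simp⟩
  add_mem' := by
    intro a b ha hb i
    obtain ⟨p, hp⟩ := ha i
    obtain ⟨q, hq⟩ := hb i
    exact ⟨p + q, by simp [hp, hq]⟩
  neg_mem' := by
    intro a ha i
    obtain ⟨p, hp⟩ := ha i
    exact ⟨-p, by simp [hp]⟩

open scoped Classical in
/-- Covolume (fundamental volume) of a subgroup of `ℝ^m` generated by some
linearly independent family of vectors; junk value `0` otherwise. -/
def latticeDet {m : ℕ} (Γ : AddSubgroup (Fin m → ℝ)) : ℝ :=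
  if h : ∃ r : ℕ, ∃ v : Fin r → Fin m → ℝ, LinearIndependent ℝ v ∧
      AddSubgroup.closure (Set.range v) = Γ
  then covol h.choose_spec.choose
  else 0

/-- The triple of consecutive best approximation vectors around index `r` is
linearly independent. -/
def tripleIndep {m : ℕ} (z : ℕ → Fin m → ℤ) (r : ℕ) : Prop :=
  LinearIndependent ℝ ![vecR (z (r - 1)), vecR (z r), vecR (z (r + 1))]

/-- Real span of the triple of consecutive vectors around index `r`. -/
def tripleSpan {m : ℕ} (z : ℕ → Fin m → ℤ) (r : ℕ) : Submodule ℝ (Fin m → ℝ) :=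
  Submodule.span ℝ ({vecR (z (r - 1)), vecR (z r), vecR (z (r + 1))} : Set (Fin m → ℝ))

/-- Subgroup of `ℝ^m` generated by the vectors of indices `a` and `b`. -/
def pairLat {m : ℕ} (z : ℕ → Fin m → ℤ) (a b : ℕ) : AddSubgroup (Fin m → ℝ) :=
  AddSubgroup.closure ({vecR (z a), vecR (z b)} : Set (Fin m → ℝ))

open Module Submodule

section Approximation

variable {n : ℕ} {θ : Fin n → ℝ}

lemma abs_le_xi (θ : Fin n → ℝ) (z : Fin (n + 1) → ℤ) (i : Fin n) :
    |(z 0 : ℝ) * θ i - (z i.succ : ℝ)| ≤ xi θ z :=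
  le_ciSup (f := fun i : Fin n => |(z 0 : ℝ) * θ i - (z i.succ : ℝ)|)
    (Set.finite_range _).bddAbove i

lemma xi_nonneg (θ : Fin n → ℝ) (z : Fin (n + 1) → ℤ) : 0 ≤ xi θ z :=
  Real.iSup_nonneg fun _ => abs_nonneg _

lemma vecR_mem_intPoints {m : ℕ} (z : Fin m → ℤ) : vecR z ∈ intPoints m :=
  fun i => ⟨z i, rfl⟩

variable {z : ℕ → Fin (n + 1) → ℤ}

lemma IsBestApproxSeq.xi_le_half (hz : IsBestApproxSeq θ z) (l : ℕ) : xi θ (z l) ≤ 1 / 2 := by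
  refine (hz.2.2.2 l (z l 0) (hz.1 l) (hz.2.1 (Nat.lt_succ_self l))
    fun i => round ((z l 0 : ℝ) * θ i)).trans ?_
  exact Real.iSup_le (fun i => abs_sub_round _) (by norm_num)

lemma abs_le_of_vecR_eq {l : ℕ}
    {w : Fin (n + 1) → ℤ} {a b : ℝ} (ha : |a| ≤ 1 / 2) (hb : |b| ≤ 1 / 2)
    (hw : vecR w = a • vecR (z l) + b • vecR (z (l + 1))) (i : Fin n) :
    |(w 0 : ℝ) * θ i - w i.succ| ≤ (xi θ (z l) + xi θ (z (l + 1))) / 2 := by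
  have h0 : (w 0 : ℝ) = a * z l 0 + b * z (l + 1) 0 := congrFun hw 0
  have h1 : (w i.succ : ℝ) = a * z l i.succ + b * z (l + 1) i.succ := congrFun hw i.succ
  have e : (w 0 : ℝ) * θ i - w i.succ = a * (z l 0 * θ i - z l i.succ) +
      b * (z (l + 1) 0 * θ i - z (l + 1) i.succ) := by rw [h0, h1]; ring
  rw [e]
  refine (abs_add_le _ _).trans ?_
  rw [abs_mul, abs_mul]
  have h2 := mul_le_mul ha (abs_le_xi θ (z l) i) (abs_nonneg _) (by norm_num)
  have h3 := mul_le_mul hb (abs_le_xi θ (z (l + 1)) i) (abs_nonneg _) (by norm_num)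
  linarith

lemma IsBestApproxSeq.apply_zero_nonpos (hz : IsBestApproxSeq θ z) {l : ℕ}
    {w : Fin (n + 1) → ℤ} {a b : ℝ} (ha : |a| ≤ 1 / 2) (hb : |b| ≤ 1 / 2)
    (hw : vecR w = a • vecR (z l) + b • vecR (z (l + 1))) : w 0 ≤ 0 := by
  by_contra! hpos
  have h0 : (w 0 : ℝ) = a * z l 0 + b * z (l + 1) 0 := congrFun hw 0
  have hl : (0 : ℝ) < z l 0 := by exact_mod_cast hz.1 l
  have hlt : (z l 0 : ℝ) < z (l + 1) 0 := by exact_mod_cast hz.2.1 (Nat.lt_succ_self l)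
  have hw0 : (w 0 : ℝ) < z (l + 1) 0 := by
    have := mul_le_mul_of_nonneg_right (le_of_abs_le ha) hl.le
    have := mul_le_mul_of_nonneg_right (le_of_abs_le hb) (hl.trans hlt).le
    linarith
  have hbest := hz.2.2.2 l (w 0) hpos (by exact_mod_cast hw0) fun i => w i.succ
  have hxi : xi θ (z (l + 1)) < xi θ (z l) := hz.2.2.1 (Nat.lt_succ_self l)
  have hsup := Real.iSup_le (abs_le_of_vecR_eq (θ := θ) ha hb hw)
    (by linarith [xi_nonneg θ (z l), xi_nonneg θ (z (l + 1))])
  linarith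

lemma IsBestApproxSeq.eq_zero_of_vecR_eq (hz : IsBestApproxSeq θ z) {l : ℕ}
    {w : Fin (n + 1) → ℤ} {a b : ℝ} (ha : |a| ≤ 1 / 2) (hb : |b| ≤ 1 / 2)
    (hw : vecR w = a • vecR (z l) + b • vecR (z (l + 1))) : w = 0 := by
  have h1 := hz.apply_zero_nonpos ha hb hw
  have h2 : (-w) 0 ≤ 0 := by
    refine hz.apply_zero_nonpos (l := l) (a := -a) (b := -b) (by rwa [abs_neg])
      (by rwa [abs_neg]) ?_
    have : vecR (-w) = -vecR w := by ext i; simp [vecR]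
    rw [this, hw, neg_smul, neg_smul, neg_add]
  have h0 : w 0 = 0 := by rw [Pi.neg_apply] at h2; omega
  ext i
  refine Fin.cases h0 (fun i => ?_) i
  have hxi : xi θ (z (l + 1)) < xi θ (z l) := hz.2.2.1 (Nat.lt_succ_self l)
  have hi := abs_le_of_vecR_eq (θ := θ) ha hb hw i
  rw [h0, Int.cast_zero, zero_mul, zero_sub, abs_neg] at hi
  have : |(w i.succ : ℝ)| < 1 := by linarith [hz.xi_le_half l]
  exact Int.abs_lt_one_iff.mp (by exact_mod_cast this)

/-- Two consecutive best approximation vectors generate all integer points of their span. -/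
lemma IsBestApproxSeq.pairLat_succ (hz : IsBestApproxSeq θ z) (l : ℕ) :
    pairLat z l (l + 1) =
      (span ℝ {vecR (z l), vecR (z (l + 1))}).toAddSubgroup ⊓ intPoints (n + 1) := by
  apply le_antisymm
  · refine (AddSubgroup.closure_le _).mpr ?_
    rintro x (rfl | rfl)
    · exact ⟨subset_span (by simp), vecR_mem_intPoints _⟩
    · exact ⟨subset_span (by simp), vecR_mem_intPoints _⟩
  · rintro x ⟨hx, hint⟩
    obtain ⟨a, b, rfl⟩ := mem_span_pair.mp hx
    choose w hw using hint
    have hzero := hz.eq_zero_of_vecR_eq (l := l)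
      (w := fun i => w i - round a * z l i - round b * z (l + 1) i)
      (abs_sub_round a) (abs_sub_round b) (by
        ext i
        have := hw i
        simp only [vecR, Pi.add_apply, Pi.smul_apply, smul_eq_mul] at this ⊢
        push_cast
        rw [← this]
        ring)
    have e : a • vecR (z l) + b • vecR (z (l + 1)) =
        round a • vecR (z l) + round b • vecR (z (l + 1)) := by
      ext i
      rw [hw i]
      have hi : w i - round a * z l i - round b * z (l + 1) i = 0 := congrFun hzero i
      have hi' : w i = round a * z l i + round b * z (l + 1) i := by linarith
      rw [hi']
      simp [vecR]
    rw [e]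
    exact add_mem (zsmul_mem (AddSubgroup.subset_closure (by simp)) _)
      (zsmul_mem (AddSubgroup.subset_closure (by simp)) _)

lemma IsBestApproxSeq.linearIndependent_pair (hz : IsBestApproxSeq θ z) (l : ℕ) :
    LinearIndependent ℝ ![vecR (z l), vecR (z (l + 1))] := by
  have hl : (0 : ℝ) < z l 0 := by exact_mod_cast hz.1 l
  have hlt : (z l 0 : ℝ) < z (l + 1) 0 := by exact_mod_cast hz.2.1 (Nat.lt_succ_self l)
  have hne : vecR (z l) ≠ 0 := fun h => hl.ne' (congrFun h 0)
  refine (LinearIndependent.pair_iff' hne).mpr fun c hc => ?_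
  have h0 : c * z l 0 = z (l + 1) 0 := congrFun hc 0
  have hc1 : 1 < c := by
    by_contra! h
    have := mul_le_mul_of_nonneg_right h hl.le
    linarith
  have hxi : xi θ (z (l + 1)) < xi θ (z l) := hz.2.2.1 (Nat.lt_succ_self l)
  refine hxi.not_ge (Real.iSup_le (fun i => ?_) (xi_nonneg _ _))
  have hi : c * z l i.succ = z (l + 1) i.succ := congrFun hc i.succ
  refine le_trans ?_ (abs_le_xi θ (z (l + 1)) i)
  rw [← h0, ← hi, mul_assoc, ← mul_sub, abs_mul]
  exact le_mul_of_one_le_left (abs_nonneg _) (hc1.le.trans (le_abs_self c))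

end Approximation

section LinearAlgebra

variable {V : Type*} [AddCommGroup V] [Module ℝ V] [FiniteDimensional ℝ V]

lemma linearIndependent_of_le_finrank {k : ℕ} {v : Fin k → V} {W : Submodule ℝ V}
    (hW : W ≤ span ℝ (Set.range v)) (hk : k ≤ finrank ℝ W) : LinearIndependent ℝ v := by
  rw [linearIndependent_iff_card_le_finrank_span, Fintype.card_fin]
  exact hk.trans (Submodule.finrank_mono hW)

lemma finrank_lt_finrank_sup {A B : Submodule ℝ V} (h : ¬ B ≤ A) :
    finrank ℝ A < finrank ℝ ↥(A ⊔ B) :=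
  Submodule.finrank_lt_finrank_of_lt (left_lt_sup.mpr h)

lemma inf_eq_of_ne {k : ℕ} {P A B : Submodule ℝ V} (hA : finrank ℝ A = k + 1)
    (hB : finrank ℝ B = k + 1) (hP : finrank ℝ P = k) (hPA : P ≤ A) (hPB : P ≤ B)
    (h : A ≠ B) : A ⊓ B = P := by
  refine (Submodule.eq_of_le_of_finrank_le (le_inf hPA hPB) ?_).symm
  have hlt : A ⊓ B < A := inf_lt_left.mpr fun hAB =>
    h (Submodule.eq_of_le_of_finrank_eq hAB (hA.trans hB.symm))
  have := Submodule.finrank_lt_finrank_of_lt hlt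
  omega

/-- A sequence of subspaces of the same dimension `k + 1`, neighbours meeting in dimension at least
`k`, none of whose tails lies in a subspace of dimension at most `k + 2`, contains two changes,
separated by a constant block, involving subspaces that span a space of dimension larger
than `k + 2`. -/
lemma exists_block {k : ℕ} {T : ℕ → Submodule ℝ V} (hT : ∀ i, finrank ℝ (T i) = k + 1)
    (hinf : ∀ i, k ≤ finrank ℝ ↥(T i ⊓ T (i + 1)))
    (htail : ∀ m (W : Submodule ℝ V), finrank ℝ W ≤ k + 2 → ∃ i, m ≤ i ∧ ¬ T i ≤ W) :
    ∃ i j, i < j ∧ T i ≠ T (i + 1) ∧ T (i + 1) = T j ∧ T j ≠ T (j + 1) ∧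
      k + 2 < finrank ℝ ↥(T i ⊔ T (i + 1) ⊔ T (j + 1)) := by
  classical
  have hne_le {i j : ℕ} (h : T i ≠ T j) : ¬ T j ≤ T i := fun hle =>
    h (Submodule.eq_of_le_of_finrank_eq hle ((hT _).trans (hT _).symm)).symm
  obtain ⟨p, hp⟩ : ∃ p, T p ≠ T (p + 1) := by
    by_contra! h
    obtain ⟨i, -, hi⟩ := htail 0 (T 0) (by rw [hT]; omega)
    exact hi (le_of_eq (by
      clear hi
      induction i with
      | zero => rfl
      | succ i ih => rw [← h i, ih]))
  set W := T p ⊔ T (p + 1) with hWdef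
  have hW : finrank ℝ W ≤ k + 2 := by
    have h1 := Submodule.finrank_sup_add_finrank_inf_eq (T p) (T (p + 1))
    have h2 := hinf p
    rw [hT, hT, ← hWdef] at h1
    omega
  have hex := htail p W hW
  obtain ⟨hpq, hq⟩ := Nat.find_spec hex
  have hmin : ∀ i, p ≤ i → i < Nat.find hex → T i ≤ W := fun i h1 h2 => by
    have := Nat.find_min hex h2
    tauto
  set q := Nat.find hex
  have hqp : q ≠ p := fun h => hq (h ▸ le_sup_left)
  have hqp' : q ≠ p + 1 := fun h => hq (h ▸ le_sup_right)
  obtain ⟨j, hj⟩ : ∃ j, q = j + 1 := ⟨q - 1, by omega⟩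
  have hpj : p < j := by omega
  obtain ⟨i, hpi, hij, hne, hblock⟩ : ∃ i, p ≤ i ∧ i < j ∧ T i ≠ T (i + 1) ∧ T (i + 1) = T j := by
    have hex' : ∃ d, T (j - d) ≠ T j ∧ d ≤ j - p := by
      by_cases h : T p = T j
      · exact ⟨j - (p + 1), by
          rw [Nat.sub_sub_self (by omega), ← h]; exact hp.symm, by omega⟩
      · exact ⟨j - p, by rwa [Nat.sub_sub_self hpj.le], le_rfl⟩
    obtain ⟨h1, h2⟩ := Nat.find_spec hex'
    have hd : Nat.find hex' ≠ 0 := fun h => by simp [h] at h1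
    have h3 := Nat.find_min hex' (m := Nat.find hex' - 1) (by omega)
    set d := Nat.find hex'
    have h4 : T (j - d + 1) = T j := by
      have : j - (d - 1) = j - d + 1 := by omega
      rw [this] at h3
      by_contra h
      exact h3 ⟨h, by omega⟩
    exact ⟨j - d, by omega, by omega, by rwa [h4], h4⟩
  have hsup : T i ⊔ T (i + 1) = W := by
    refine Submodule.eq_of_le_of_finrank_le
      (sup_le (hmin i hpi (by omega)) (hmin (i + 1) (by omega) (by omega))) ?_
    have := finrank_lt_finrank_sup (hne_le hne)
    rw [hT] at this
    omega
  have hle := finrank_lt_finrank_sup (hne_le hne)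
  rw [hT] at hle
  refine ⟨i, j, hij, hne, hblock, fun h => hq ?_, ?_⟩
  · rw [hj, ← h]
    exact hmin j hpj.le (by omega)
  · rw [hj, ← hsup] at hq
    have := finrank_lt_finrank_sup hq
    omega

end LinearAlgebra

section Triples

variable {m : ℕ} {z : ℕ → Fin m → ℤ}

lemma vecR_mem_tripleSpan (z : ℕ → Fin m → ℤ) (r : ℕ) :
    vecR (z (r - 1)) ∈ tripleSpan z r ∧ vecR (z r) ∈ tripleSpan z r ∧
      vecR (z (r + 1)) ∈ tripleSpan z r :=
  ⟨subset_span (by simp), subset_span (by simp), subset_span (by simp)⟩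

lemma tripleSpan_le {r : ℕ} {W : Submodule ℝ (Fin m → ℝ)} (h1 : vecR (z (r - 1)) ∈ W)
    (h2 : vecR (z r) ∈ W) (h3 : vecR (z (r + 1)) ∈ W) : tripleSpan z r ≤ W := by
  refine span_le.mpr ?_
  rintro x (rfl | rfl | rfl) <;> assumption

lemma tripleIndep.finrank_tripleSpan {r : ℕ} (h : tripleIndep z r) :
    finrank ℝ (tripleSpan z r) = 3 := by
  have := finrank_span_eq_card h
  rwa [Matrix.range_cons, Matrix.range_cons, Matrix.range_cons, Matrix.range_empty,
    Set.union_empty, Fintype.card_fin] at this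

lemma span_pair_le {a b : ℕ} {W : Submodule ℝ (Fin m → ℝ)} (h1 : vecR (z a) ∈ W)
    (h2 : vecR (z b) ∈ W) : span ℝ {vecR (z a), vecR (z b)} ≤ W := by
  refine span_le.mpr ?_
  rintro x (rfl | rfl) <;> assumption

lemma mem_span_of_not_tripleIndep
    (hpair : ∀ l, finrank ℝ (span ℝ {vecR (z l), vecR (z (l + 1))}) = 2) {l : ℕ}
    (h : ¬ tripleIndep z (l + 1)) :
    vecR (z (l + 2)) ∈ span ℝ {vecR (z l), vecR (z (l + 1))} := by
  by_contra hmem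
  refine h (linearIndependent_of_le_finrank
    (W := span ℝ {vecR (z l), vecR (z (l + 1))} ⊔ span ℝ {vecR (z (l + 2))}) ?_ ?_)
  · refine sup_le (span_mono ?_) (span_mono ?_)
    · rintro x (rfl | rfl)
      · exact ⟨0, rfl⟩
      · exact ⟨1, rfl⟩
    · rintro x rfl
      exact ⟨2, rfl⟩
  · have := finrank_lt_finrank_sup
      (fun hle => hmem (hle (mem_span_singleton_self (vecR (z (l + 2))))))
    rw [hpair] at this
    exact this

lemma span_pair_eq_of_forall_not_tripleIndep
    (hpair : ∀ l, finrank ℝ (span ℝ {vecR (z l), vecR (z (l + 1))}) = 2) {a b : ℕ} (hab : a ≤ b)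
    (h : ∀ r, a < r → r ≤ b → ¬ tripleIndep z r) :
    span ℝ {vecR (z a), vecR (z (a + 1))} = span ℝ {vecR (z b), vecR (z (b + 1))} := by
  induction b, hab using Nat.le_induction with
  | base => rfl
  | succ b hab ih =>
    rw [ih fun r h1 h2 => h r h1 (by omega)]
    refine (Submodule.eq_of_le_of_finrank_eq (span_pair_le (subset_span (by simp)) ?_)
      ((hpair _).trans (hpair _).symm)).symm
    exact mem_span_of_not_tripleIndep hpair (h (b + 1) (by omega) le_rfl)

lemma eq_top_of_vecR_mem
    (hpair : ∀ l, finrank ℝ (span ℝ {vecR (z l), vecR (z (l + 1))}) = 2)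
    (hspan : ∀ k₀ : ℕ, span ℝ {x : Fin m → ℝ | ∃ l, k₀ ≤ l ∧ x = vecR (z l)} = ⊤)
    {W : Submodule ℝ (Fin m → ℝ)} {k : ℕ} (h0 : vecR (z k) ∈ W) (h1 : vecR (z (k + 1)) ∈ W)
    (h : ∀ r, k < r → tripleIndep z r → vecR (z (r + 1)) ∈ W) : W = ⊤ := by
  have key : ∀ l, k ≤ l → vecR (z l) ∈ W ∧ vecR (z (l + 1)) ∈ W := by
    intro l hl
    induction l, hl using Nat.le_induction with
    | base => exact ⟨h0, h1⟩
    | succ l hl ih =>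
      refine ⟨ih.2, ?_⟩
      by_cases ht : tripleIndep z (l + 1)
      · exact h _ (by omega) ht
      · exact span_pair_le ih.1 ih.2 (mem_span_of_not_tripleIndep hpair ht)
  rw [eq_top_iff, ← hspan k, span_le]
  rintro x ⟨l, hl, rfl⟩
  exact (key l hl).1

end Triples

/-- The pattern for simultaneous approximation to four numbers. -/
theorem statement13 (θ : Fin 4 → ℝ)
    (hθ : LinearIndependent ℚ (Fin.cons (1 : ℝ) θ : Fin (4 + 1) → ℝ))
    (z : ℕ → Fin (4 + 1) → ℤ) (hz : IsBestApproxSeq θ z)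
    (hspan : ∀ k₀ : ℕ,
      Submodule.span ℝ {x : Fin (4 + 1) → ℝ | ∃ l, k₀ ≤ l ∧ x = vecR (z l)} = ⊤) :
    ∀ k₀ : ℕ, ∃ r₀ r₁ r₂ r₃ : ℕ, k₀ < r₀ ∧ r₀ < r₁ ∧ r₁ ≤ r₂ ∧ r₂ < r₃ ∧
      (tripleIndep z r₀ ∧ tripleIndep z r₁ ∧ tripleIndep z r₂ ∧ tripleIndep z r₃) ∧
      tripleSpan z r₁ = tripleSpan z r₂ ∧
      (pairLat z r₀ (r₀ + 1) = pairLat z (r₁ - 1) r₁ ∧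
        pairLat z r₀ (r₀ + 1) =
          (tripleSpan z r₀).toAddSubgroup ⊓ (tripleSpan z r₁).toAddSubgroup ⊓
            intPoints (4 + 1)) ∧
      (pairLat z r₂ (r₂ + 1) = pairLat z (r₃ - 1) r₃ ∧
        pairLat z r₂ (r₂ + 1) =
          (tripleSpan z r₂).toAddSubgroup ⊓ (tripleSpan z r₃).toAddSubgroup ⊓
            intPoints (4 + 1)) ∧
      LinearIndependent ℝ
        ![vecR (z (r₀ - 1)), vecR (z r₀), vecR (z (r₀ + 1)), vecR (z (r₁ + 1))] ∧
      LinearIndependent ℝ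
        ![vecR (z (r₂ - 1)), vecR (z (r₃ - 1)), vecR (z r₃), vecR (z (r₃ + 1))] ∧
      Submodule.span ℝ ({vecR (z (r₀ - 1)), vecR (z r₀), vecR (z (r₀ + 1)),
        vecR (z (r₁ + 1)), vecR (z (r₃ + 1))} : Set (Fin (4 + 1) → ℝ)) = ⊤ := by
  intro k₀
  have hpair : ∀ l, finrank ℝ (span ℝ {vecR (z l), vecR (z (l + 1))}) = 2 := fun l => by
    have := finrank_span_eq_card (hz.linearIndependent_pair l)
    rwa [Matrix.range_cons, Matrix.range_cons, Matrix.range_empty, Set.union_empty,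
      Fintype.card_fin] at this
  have hfive : finrank ℝ (Fin (4 + 1) → ℝ) = 5 := by simp
  set p : ℕ → Prop := fun r => k₀ < r ∧ tripleIndep z r
  have hinf : (Set.ofPred p).Infinite := by
    refine Set.infinite_of_not_bddAbove ?_
    rintro ⟨N, hN⟩
    have htop := eq_top_of_vecR_mem hpair hspan (k := max N k₀)
      (W := span ℝ {vecR (z (max N k₀)), vecR (z (max N k₀ + 1))})
      (subset_span (by simp)) (subset_span (by simp)) fun r hr ht =>
        absurd (hN (show p r from ⟨(le_max_right _ _).trans_lt hr, ht⟩))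
          (not_le.mpr ((le_max_left _ _).trans_lt hr))
    have := hpair (max N k₀)
    rw [htop, finrank_top, hfive] at this
    omega
  set s := Nat.nth p
  have hsp : ∀ i, p (s i) := Nat.nth_mem_of_infinite hinf
  have hmono : StrictMono s := Nat.nth_strictMono hinf
  have hfind : ∀ r, p r → ∃ i, s i = r := fun r hr => by
    have : r ∈ Set.range (Nat.nth p) := by rw [Nat.range_nth_of_infinite hinf]; exact hr
    exact this
  have hplane : ∀ i, span ℝ {vecR (z (s i)), vecR (z (s i + 1))} =
      span ℝ {vecR (z (s (i + 1) - 1)), vecR (z (s (i + 1)))} := fun i => by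
    have hlt : s i < s (i + 1) := hmono (Nat.lt_succ_self i)
    have := span_pair_eq_of_forall_not_tripleIndep hpair (a := s i) (b := s (i + 1) - 1)
      (by omega) fun r h1 h2 ht => by
        obtain ⟨j, rfl⟩ := hfind r ⟨(hsp i).1.trans h1, ht⟩
        have h3 := hmono.lt_iff_lt.mp h1
        have h4 := hmono.lt_iff_lt.mp (show s j < s (i + 1) by omega)
        omega
    rwa [Nat.sub_add_cancel (by omega)] at this
  have hleft : ∀ i, span ℝ {vecR (z (s i)), vecR (z (s i + 1))} ≤ tripleSpan z (s i) :=
    fun i => span_pair_le (vecR_mem_tripleSpan z _).2.1 (vecR_mem_tripleSpan z _).2.2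
  have hright : ∀ i, span ℝ {vecR (z (s i)), vecR (z (s i + 1))} ≤ tripleSpan z (s (i + 1)) :=
    fun i => hplane i ▸
      span_pair_le (vecR_mem_tripleSpan z _).1 (vecR_mem_tripleSpan z _).2.1
  have hdim : ∀ i, finrank ℝ (tripleSpan z (s i)) = 3 := fun i =>
    (hsp i).2.finrank_tripleSpan
  obtain ⟨i, j, hij, hi, hblock, hj, hbig⟩ := exists_block (k := 2)
    (T := fun i => tripleSpan z (s i)) hdim
    (fun i => (hpair (s i)).ge.trans (Submodule.finrank_mono (le_inf (hleft i) (hright i))))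
    (fun m W hW => by
      by_contra! h
      have htop := eq_top_of_vecR_mem hpair hspan (k := s m) (W := W)
        (h m le_rfl (vecR_mem_tripleSpan z _).2.1) (h m le_rfl (vecR_mem_tripleSpan z _).2.2)
        fun r hr ht => by
          obtain ⟨j, rfl⟩ := hfind r ⟨(hsp m).1.trans hr, ht⟩
          exact h j (hmono.lt_iff_lt.mp hr).le (vecR_mem_tripleSpan z _).2.2
      rw [htop, finrank_top, hfive] at hW
      omega)
  have hlat : ∀ i, tripleSpan z (s i) ≠ tripleSpan z (s (i + 1)) →
      pairLat z (s i) (s i + 1) = pairLat z (s (i + 1) - 1) (s (i + 1)) ∧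
      pairLat z (s i) (s i + 1) = (tripleSpan z (s i)).toAddSubgroup ⊓
        (tripleSpan z (s (i + 1))).toAddSubgroup ⊓ intPoints (4 + 1) := fun i hi => by
    have hpos := (hsp (i + 1)).1
    have h2 := hz.pairLat_succ (s (i + 1) - 1)
    rw [Nat.sub_add_cancel (by omega)] at h2
    refine ⟨by rw [hz.pairLat_succ, h2, hplane], ?_⟩
    rw [hz.pairLat_succ, ← inf_eq_of_ne (hdim i) (hdim (i + 1)) (hpair (s i)) (hleft i) (hright i)
      hi]
    rfl
  have hfour : ∀ i, tripleSpan z (s i) ≠ tripleSpan z (s (i + 1)) →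
      4 ≤ finrank ℝ ↥(tripleSpan z (s i) ⊔ tripleSpan z (s (i + 1))) := fun i hi => by
    have := finrank_lt_finrank_sup (A := tripleSpan z (s i)) (B := tripleSpan z (s (i + 1)))
      fun hle => hi
        (Submodule.eq_of_le_of_finrank_eq hle ((hdim _).trans (hdim _).symm)).symm
    rwa [hdim] at this
  have hnext : ∀ i (W : Submodule ℝ (Fin (4 + 1) → ℝ)), vecR (z (s i)) ∈ W →
      vecR (z (s i + 1)) ∈ W → vecR (z (s (i + 1) + 1)) ∈ W → tripleSpan z (s (i + 1)) ≤ W :=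
    fun i W h1 h2 h3 => by
      have hle := span_pair_le h1 h2
      rw [hplane] at hle
      exact tripleSpan_le (hle (subset_span (by simp))) (hle (subset_span (by simp))) h3
  refine ⟨s i, s (i + 1), s j, s (j + 1), (hsp i).1, hmono (Nat.lt_succ_self i),
    hmono.monotone hij, hmono (Nat.lt_succ_self j),
    ⟨(hsp _).2, (hsp _).2, (hsp _).2, (hsp _).2⟩, hblock, hlat i hi, hlat j hj,
    linearIndependent_of_le_finrank (sup_le ?_ ?_) (hfour i hi),
    linearIndependent_of_le_finrank (sup_le ?_ ?_) (hfour j hj), ?_⟩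
  · exact tripleSpan_le (subset_span ⟨0, rfl⟩) (subset_span ⟨1, rfl⟩) (subset_span ⟨2, rfl⟩)
  · exact hnext i _ (subset_span ⟨1, rfl⟩) (subset_span ⟨2, rfl⟩) (subset_span ⟨3, rfl⟩)
  · have hle : span ℝ {vecR (z (s j)), vecR (z (s j + 1))} ≤ span ℝ (Set.range
        ![vecR (z (s j - 1)), vecR (z (s (j + 1) - 1)), vecR (z (s (j + 1))),
          vecR (z (s (j + 1) + 1))]) := by
      rw [hplane]
      exact span_pair_le (subset_span ⟨1, rfl⟩) (subset_span ⟨2, rfl⟩)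
    exact tripleSpan_le (subset_span ⟨0, rfl⟩) (hle (subset_span (by simp)))
      (hle (subset_span (by simp)))
  · exact tripleSpan_le (subset_span ⟨1, rfl⟩) (subset_span ⟨2, rfl⟩) (subset_span ⟨3, rfl⟩)
  · set W := span ℝ ({vecR (z (s i - 1)), vecR (z (s i)), vecR (z (s i + 1)),
      vecR (z (s (i + 1) + 1)), vecR (z (s (j + 1) + 1))} : Set (Fin (4 + 1) → ℝ))
    have h0 : tripleSpan z (s i) ≤ W :=
      tripleSpan_le (subset_span (by simp)) (subset_span (by simp)) (subset_span (by simp))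
    have h1 : tripleSpan z (s (i + 1)) ≤ W :=
      hnext i _ (subset_span (by simp)) (subset_span (by simp)) (subset_span (by simp))
    have h2 : tripleSpan z (s j) ≤ W := hblock ▸ h1
    have h3 : tripleSpan z (s (j + 1)) ≤ W :=
      hnext j _ (h2 (vecR_mem_tripleSpan z _).2.1) (h2 (vecR_mem_tripleSpan z _).2.2)
        (subset_span (by simp))
    have hW := hbig.trans_le (Submodule.finrank_mono (sup_le (sup_le h0 h1) h3))
    refine Submodule.eq_top_of_finrank_eq (le_antisymm (Submodule.finrank_le W) ?_)
    rw [hfive]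
    exact hW


end
end

section
/- Let n ≥ 4 be an integer, let α ∈ (0,1), and let g = G(n,α) be the unique positive root of R_{n,α}. Then: (a) R_{k,α}(g) > 0 for every integer 2 ≤ k ≤ n−1; (b) R_{n−1,α}(g)/(g·R_{n−2,α}(g)) + R_{n−1,α}(g)/R_{n−2,α}(g) = 1; (c) for every integer 4 ≤ k ≤ n−1, F( R_{k,α}(g)/(g·R_{k−1,α}(g)), R_{k,α}(g)/R_{k−1,α}(g) ) = ( R_{k−1,α}(g)/(g·R_{k−2,α}(g)), R_{k−1,α}(g)/R_{k−2,α}(g) ), where F(y,z) = ( y/(y+z−yz), z/(y+z−yz) ). -/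
open scoped BigOperators

noncomputable section

/-- `R_{n,α}(x) = x^(n-1) - (α/(1-α)) * (x^(n-2) + ⋯ + x + 1)`. -/
def Rpoly (n : ℕ) (α : ℝ) (x : ℝ) : ℝ :=
  x ^ (n - 1) - α / (1 - α) * ∑ i ∈ Finset.range (n - 1), x ^ i

theorem Rpoly_succ {k : ℕ} (hk : 1 ≤ k) (α x : ℝ) :
    Rpoly (k + 1) α x = x * Rpoly k α x - α / (1 - α) := by
  obtain ⟨m, rfl⟩ := Nat.exists_eq_add_of_le' hk
  simp only [Rpoly, Nat.add_sub_cancel]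
  rw [Finset.sum_range_succ', pow_succ']
  simp only [pow_succ', ← Finset.mul_sum, pow_zero]
  ring

theorem Rpoly_pos_of_succ_nonneg {k : ℕ} (hk : 1 ≤ k) {α x : ℝ} (hα0 : 0 < α) (hα1 : α < 1)
    (hx : 0 < x) (h : 0 ≤ Rpoly (k + 1) α x) : 0 < Rpoly k α x := by
  rw [Rpoly_succ hk] at h
  have hc : 0 < α / (1 - α) := div_pos hα0 (sub_pos.2 hα1)
  exact pos_of_mul_pos_right (by linarith : 0 < x * Rpoly k α x) hx.le

theorem Rpoly_pos_of_lt_of_root {k n : ℕ} (hk : 1 ≤ k) (hkn : k < n) {α x : ℝ} (hα0 : 0 < α)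
    (hα1 : α < 1) (hx : 0 < x) (hroot : Rpoly n α x = 0) : 0 < Rpoly k α x := by
  have hle : k ≤ n - 1 := Nat.le_sub_one_of_lt hkn
  induction hle using Nat.decreasingInduction with
  | self =>
    apply Rpoly_pos_of_succ_nonneg hk hα0 hα1 hx
    rw [Nat.sub_add_cancel (by omega), hroot]
  | of_succ j hj ih =>
    exact Rpoly_pos_of_succ_nonneg hk hα0 hα1 hx (ih (by omega) (by omega)).le

/-- Properties of the values `R_{k,α}(g)` at the unique positive root `g` of
`R_{n,α}`, including the fixed-point relations for the map
`F(y,z) = (y/(y+z-yz), z/(y+z-yz))`. -/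
theorem statement15 {n : ℕ} (hn : 4 ≤ n) (α : ℝ) (hα0 : 0 < α) (hα1 : α < 1)
    (g : ℝ) (hg : 0 < g) (hroot : Rpoly n α g = 0) :
    (∀ k : ℕ, 2 ≤ k → k ≤ n - 1 → 0 < Rpoly k α g) ∧
    Rpoly (n - 1) α g / (g * Rpoly (n - 2) α g) + Rpoly (n - 1) α g / Rpoly (n - 2) α g = 1 ∧
    (∀ k : ℕ, 4 ≤ k → k ≤ n - 1 →
      (let y := Rpoly k α g / (g * Rpoly (k - 1) α g)
       let zz := Rpoly k α g / Rpoly (k - 1) α g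
       (y / (y + zz - y * zz), zz / (y + zz - y * zz)) =
         (Rpoly (k - 1) α g / (g * Rpoly (k - 2) α g),
          Rpoly (k - 1) α g / Rpoly (k - 2) α g))) := by
  have hpos (k : ℕ) (hk : 1 ≤ k) (hkn : k < n) : 0 < Rpoly k α g :=
    Rpoly_pos_of_lt_of_root hk hkn hα0 hα1 hg hroot
  refine ⟨fun k hk hkn ↦ hpos k (by omega) (by omega), ?_, fun k hk hkn ↦ ?_⟩
  · obtain ⟨m, rfl⟩ := Nat.exists_eq_add_of_le' (show 2 ≤ n by omega)
    have hm := hpos m (by omega) (by omega)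
    rw [Rpoly_succ (k := m + 1) (by omega)] at hroot
    have hstep := Rpoly_succ (k := m) (by omega) α g
    simp only [Nat.add_sub_cancel, show m + 2 - 1 = m + 1 by omega]
    field_simp
    linarith
  · obtain ⟨m, rfl⟩ := Nat.exists_eq_add_of_le' (show 2 ≤ k by omega)
    have hm := hpos m (by omega) (by omega)
    have hm1 := hpos (m + 1) (by omega) (by omega)
    have hm2 := hpos (m + 2) (by omega) (by omega)
    have hstep := Rpoly_succ (k := m) (by omega) α g
    have hstep' := Rpoly_succ (k := m + 1) (by omega) α g
    simp only [Nat.add_sub_cancel, show m + 2 - 1 = m + 1 by omega]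
    rw [show m + 1 + 1 = m + 2 by omega] at hstep'
    generalize Rpoly m α g = d at *
    generalize Rpoly (m + 1) α g = b at *
    generalize Rpoly (m + 2) α g = a at *
    have hden : a / (g * b) + a / b - a / (g * b) * (a / b) = a * d / b ^ 2 := by
      field_simp
      linarith
    rw [hden]
    ext <;> field_simp

end
end

section
/- Let y₀, z₀ ∈ (0,1) with y₀ + z₀ = 1. Define recursively (y_{k+1}, z_{k+1}) = ( y_k/(y_k+z_k−y_k z_k), z_k/(y_k+z_k−y_k z_k) ). Define w_{0,0} = w'_{0,0} = 1 and, for k ≥ 0 and 0 ≤ l ≤ 2^k−1: w_{k+1,2l} = w_{k,l}, w_{k+1,2l+1} = (1−z_k)·w'_{k,l}, w'_{k+1,2l} = (1−y_k)·w_{k,l}, w'_{k+1,2l+1} = w'_{k,l}. Then for every k ≥ 0: y_k, z_k ∈ (0,1), ∑_{l=0}^{2^k−1} (w_{k,l} + w'_{k,l}) = k+2, and ∑_{l=0}^{2^k−1} ((2−y_k)·w_{k,l} + (2−z_k)·w'_{k,l}) = k+3. -/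
open scoped BigOperators

theorem Finset.sum_range_two_mul_eq_sum_add {M : Type*} [AddCommMonoid M] (f : ℕ → M) (n : ℕ) :
    ∑ i ∈ Finset.range (2 * n), f i = ∑ i ∈ Finset.range n, (f (2 * i) + f (2 * i + 1)) := by
  induction n with
  | zero => simp
  | succ n ih =>
    rw [Nat.mul_succ, Finset.sum_range_succ, Finset.sum_range_succ, ih, Finset.sum_range_succ,
      add_assoc]

/-- The open unit interval is stable under `(a, b) ↦ a / (a + b - a * b)`. -/
theorem div_add_sub_mul_mem_Ioo {a b : ℝ} (ha : a ∈ Set.Ioo (0 : ℝ) 1)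
    (hb : b ∈ Set.Ioo (0 : ℝ) 1) : a / (a + b - a * b) ∈ Set.Ioo (0 : ℝ) 1 := by
  obtain ⟨ha0, ha1⟩ := ha
  have h : 0 < b * (1 - a) := mul_pos hb.1 (sub_pos.2 ha1)
  have hD : 0 < a + b - a * b := by linarith
  exact ⟨div_pos ha0 hD, (div_lt_one hD).2 (by linarith)⟩

/-- Properties of the recursively defined parameters `y_k, z_k, w_{k,l}, w'_{k,l}`
used in the optimization of Schmidt's inequalities. -/
theorem statement16 (y z : ℕ → ℝ) (w w' : ℕ → ℕ → ℝ)
    (hy0 : y 0 ∈ Set.Ioo (0 : ℝ) 1) (hz0 : z 0 ∈ Set.Ioo (0 : ℝ) 1)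
    (hsum0 : y 0 + z 0 = 1)
    (hyzrec : ∀ k : ℕ,
      y (k + 1) = y k / (y k + z k - y k * z k) ∧
      z (k + 1) = z k / (y k + z k - y k * z k))
    (hw00 : w 0 0 = 1) (hw'00 : w' 0 0 = 1)
    (hwrec : ∀ k l : ℕ, l < 2 ^ k →
      w (k + 1) (2 * l) = w k l ∧
      w (k + 1) (2 * l + 1) = (1 - z k) * w' k l ∧
      w' (k + 1) (2 * l) = (1 - y k) * w k l ∧
      w' (k + 1) (2 * l + 1) = w' k l) :
    ∀ k : ℕ, y k ∈ Set.Ioo (0 : ℝ) 1 ∧ z k ∈ Set.Ioo (0 : ℝ) 1 ∧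
      (∑ l ∈ Finset.range (2 ^ k), (w k l + w' k l)) = (k : ℝ) + 2 ∧
      (∑ l ∈ Finset.range (2 ^ k), ((2 - y k) * w k l + (2 - z k) * w' k l)) = (k : ℝ) + 3 := by
  have hS (k : ℕ) : ∑ l ∈ Finset.range (2 ^ (k + 1)), w (k + 1) l =
      ∑ l ∈ Finset.range (2 ^ k), w k l + (1 - z k) * ∑ l ∈ Finset.range (2 ^ k), w' k l := by
    rw [pow_succ', Finset.sum_range_two_mul_eq_sum_add, Finset.mul_sum, ← Finset.sum_add_distrib]
    refine Finset.sum_congr rfl fun l hl => ?_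
    obtain ⟨h₁, h₂, -, -⟩ := hwrec k l (Finset.mem_range.1 hl)
    rw [h₁, h₂]
  have hT (k : ℕ) : ∑ l ∈ Finset.range (2 ^ (k + 1)), w' (k + 1) l =
      (1 - y k) * ∑ l ∈ Finset.range (2 ^ k), w k l + ∑ l ∈ Finset.range (2 ^ k), w' k l := by
    rw [pow_succ', Finset.sum_range_two_mul_eq_sum_add, Finset.mul_sum, ← Finset.sum_add_distrib]
    refine Finset.sum_congr rfl fun l hl => ?_
    obtain ⟨-, -, h₁, h₂⟩ := hwrec k l (Finset.mem_range.1 hl)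
    rw [h₁, h₂]
  intro k
  simp only [Finset.sum_add_distrib, ← Finset.mul_sum]
  induction k with
  | zero =>
    refine ⟨hy0, hz0, ?_, ?_⟩
    · norm_num [hw00, hw'00]
    · simp only [pow_zero, Finset.sum_range_one, hw00, hw'00, Nat.cast_zero]
      linarith
  | succ k ih =>
    obtain ⟨hy, hz, h₁, h₂⟩ := ih
    obtain ⟨hy', hz'⟩ := hyzrec k
    have hD : y k + z k - y k * z k ≠ 0 := by
      have := mul_pos hz.1 (sub_pos.2 hy.2)
      have := hy.1
      linarith
    rw [hS, hT]
    set S := ∑ l ∈ Finset.range (2 ^ k), w k l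
    set T := ∑ l ∈ Finset.range (2 ^ k), w' k l
    have hweighted : y (k + 1) * (S + (1 - z k) * T) + z (k + 1) * ((1 - y k) * S + T) =
        S + T := by
      rw [hy', hz']
      field_simp
      ring
    refine ⟨hy' ▸ div_add_sub_mul_mem_Ioo hy hz, ?_, ?_, ?_⟩
    · rw [hz', add_comm (y k), mul_comm (y k)]
      exact div_add_sub_mul_mem_Ioo hz hy
    · push_cast
      linarith
    · push_cast
      linarith
end

section
/- Let α* ≥ 4 be a real number and let g* = G*(4,α*) be the unique positive root of R*_{4,α*}(x) = x³+x²+x+1−α*. Set x = R*_{3,α*}(g*)/R*_{2,α*}(g*) = (α*−1−g*−g*²)/(α*−1−g*), w₁ = (α*−1−g*)/(g*·(α*−1)), and w₂ = g*/(α*−1). Then 1 ≤ g* < α*−1, x > 0, w₁ + x − 1 > 0, and 1 − x − w₂ > 0. -/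
open scoped BigOperators

noncomputable section

/-- `R*_{n,α*}(x) = x^(n-1) + x^(n-2) + ⋯ + x + 1 - α*`. -/
def Rstar (n : ℕ) (αs : ℝ) (x : ℝ) : ℝ :=
  (∑ i ∈ Finset.range n, x ^ i) - αs

/-- Numerical facts about the unique positive root `g* = G*(4,α*)` of
`R*_{4,α*}` and the parameters `x`, `w₁`, `w₂` used for approximation by one
linear form in four variables. -/
theorem statement19 (αs : ℝ) (hαs : 4 ≤ αs) (g : ℝ) (hg : 0 < g)
    (hroot : Rstar 4 αs g = 0) :
    Rstar 3 αs g / Rstar 2 αs g = (αs - 1 - g - g ^ 2) / (αs - 1 - g) ∧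
    1 ≤ g ∧ g < αs - 1 ∧
    0 < (αs - 1 - g - g ^ 2) / (αs - 1 - g) ∧
    0 < (αs - 1 - g) / (g * (αs - 1)) + (αs - 1 - g - g ^ 2) / (αs - 1 - g) - 1 ∧
    0 < 1 - (αs - 1 - g - g ^ 2) / (αs - 1 - g) - g / (αs - 1) := by
  have hα : αs = g ^ 3 + g ^ 2 + g + 1 := by
    simp only [Rstar, Finset.sum_range_succ, Finset.sum_range_zero] at hroot
    linarith
  have hg1 : 1 ≤ g := by
    by_contra! h
    have h2 : g ^ 2 < 1 := pow_lt_one₀ hg.le h two_ne_zero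
    have h3 : g ^ 3 < 1 := pow_lt_one₀ hg.le h three_ne_zero
    linarith
  have hx : (αs - 1 - g - g ^ 2) / (αs - 1 - g) = g / (1 + g) := by
    rw [hα, show g ^ 3 + g ^ 2 + g + 1 - 1 - g = g ^ 2 * (1 + g) by ring]
    field_simp
    ring
  have hw₁ : (αs - 1 - g) / (g * (αs - 1)) = (1 + g) / (1 + g + g ^ 2) := by
    rw [hα, show g ^ 3 + g ^ 2 + g + 1 - 1 - g = g ^ 2 * (1 + g) by ring,
      show g ^ 3 + g ^ 2 + g + 1 - 1 = g * (1 + g + g ^ 2) by ring]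
    field_simp
  have hw₂ : g / (αs - 1) = 1 / (1 + g + g ^ 2) := by
    rw [hα, show g ^ 3 + g ^ 2 + g + 1 - 1 = g * (1 + g + g ^ 2) by ring]
    field_simp
  refine ⟨?_, hg1, ?_, ?_, ?_, ?_⟩
  · rw [← neg_div_neg_eq]
    simp only [Rstar, Finset.sum_range_succ, Finset.sum_range_zero]
    congr 1 <;> ring
  · have : 0 < g ^ 3 + g ^ 2 := by positivity
    linarith
  · rw [hx]
    positivity
  · rw [hx, hw₁, show (1 + g) / (1 + g + g ^ 2) + g / (1 + g) - 1 =
      g / ((1 + g) * (1 + g + g ^ 2)) by field_simp; ring]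
    positivity
  · rw [hx, hw₂, show 1 - g / (1 + g) - 1 / (1 + g + g ^ 2) =
      g ^ 2 / ((1 + g) * (1 + g + g ^ 2)) by field_simp; ring]
    positivity

end
end
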